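/- arXiv:2501.08357 — 13 statements merged into one kernel-verified Lean document; each statement's English description precedes it below -/
import Mathlib

section
/- For every i in H and every natural number j, the j-fold ×-product of i with itself satisfies i^{×j} = j·i + C(j,2)·p^ν·i² in H, where C(j,2) = j(j−1)/2. -/
/-- The binary operation `i × j := i + j + p^ν i j` on `ℤ/p^η ℤ`. -/
def lcsTimes (p ν : ℕ) {n : ℕ} (i j : ZMod n) : ZMod n :=
  i + j + (p : ZMod n) ^ ν * i * j

/-- The `j`-fold `×`-product of `x` with itself (`x^{×0} = 0`). -/
def lcsTimesPow (p ν : ℕ) {n : ℕ} (x : ZMod n) : ℕ → ZMod n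
  | 0 => 0
  | j + 1 => lcsTimes p ν x (lcsTimesPow p ν x j)

theorem stmt0 (p ν η : ℕ) (hp : p.Prime) (hν : 0 < ν) (hνη : ν ≤ η) (hη2 : η ≤ 2 * ν)
    (i : ZMod (p ^ η)) (j : ℕ) :
    lcsTimesPow p ν i j =
      (j : ZMod (p ^ η)) * i + (j.choose 2 : ZMod (p ^ η)) * (p : ZMod (p ^ η)) ^ ν * i ^ 2 := by
  have hsq : (p : ZMod (p ^ η)) ^ ν * (p : ZMod (p ^ η)) ^ ν = 0 := by
    rw [← pow_add, ← two_mul]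
    exact_mod_cast (ZMod.natCast_eq_zero_iff _ _).2 (pow_dvd_pow p hη2)
  induction j with
  | zero => simp [lcsTimesPow]
  | succ j ih =>
    rw [lcsTimesPow, lcsTimes, ih, Nat.choose_succ_succ' j 1, Nat.choose_one_right]
    push_cast
    linear_combination (j.choose 2 : ZMod (p ^ η)) * i ^ 3 * hsq
end

section
/- Assume p is odd, or p = 2 and (ν,η) ≠ (1,2). If i ∈ H is a unit (that is, p does not divide val(i)), then for every natural number j one has i^{×j} = 0 if and only if p^η divides j; in particular i has order p^η in the group (H, ×), so (H, ×) is a cyclic group generated by i. -/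
theorem lcsTimesPow_add (p ν : ℕ) {n : ℕ} (x : ZMod n) (j m : ℕ) :
    lcsTimesPow p ν x (j + m) = lcsTimesPow p ν x j +
      lcsTimesPow p ν x m * (1 + (p : ZMod n) ^ ν * lcsTimesPow p ν x j) := by
  induction j with
  | zero => simp [lcsTimesPow]
  | succ j ih =>
    rw [Nat.succ_add, lcsTimesPow, ih, lcsTimesPow, lcsTimes, lcsTimes]
    ring

/-- An integer representative of `x^{×j}`, recovered from `1 + p^ν x^{×j} = (1 + p^ν x)^j`. -/
theorem exists_int_lcsTimesPow (p ν : ℕ) {n : ℕ} (a j : ℕ) :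
    ∃ T : ℤ, lcsTimesPow p ν (a : ZMod n) j = T ∧
      (p : ℤ) ^ ν * T = (1 + (p : ℤ) ^ ν * a) ^ j - 1 := by
  induction j with
  | zero => exact ⟨0, by simp [lcsTimesPow]⟩
  | succ j ih =>
    obtain ⟨T, hT, hT'⟩ := ih
    refine ⟨a + T + (p : ℤ) ^ ν * a * T, ?_, ?_⟩
    · rw [lcsTimesPow, lcsTimes, hT]
      push_cast
      ring
    · rw [pow_succ]
      linear_combination (1 + (p : ℤ) ^ ν * a) * hT'

theorem emultiplicity_one_add_pow_mul_pow_sub_one {p ν a : ℕ} (hp : p.Prime) (hν : 0 < ν)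
    (hcase : Odd p ∨ (p = 2 ∧ 2 ≤ ν)) (ha : ¬ p ∣ a) (j : ℕ) :
    emultiplicity (p : ℤ) ((1 + (p : ℤ) ^ ν * a) ^ j - 1) = ν + emultiplicity p j := by
  have hpZ : Prime (p : ℤ) := Nat.prime_iff_prime_int.mp hp
  have hsub : (1 + (p : ℤ) ^ ν * a) - 1 = (p : ℤ) ^ ν * a := by ring
  have hbase : emultiplicity (p : ℤ) ((1 + (p : ℤ) ^ ν * a) - 1) = ν := by
    rw [hsub, emultiplicity_mul hpZ, emultiplicity_pow_self_of_prime hpZ,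
      emultiplicity_eq_zero.mpr (by exact_mod_cast ha), add_zero]
  have hdvd : (p : ℤ) ∣ (p : ℤ) ^ ν * a := (dvd_pow_self _ hν.ne').mul_right _
  have hunit : ¬ (p : ℤ) ∣ 1 + (p : ℤ) ^ ν * a := fun h =>
    hpZ.not_dvd_one ((dvd_add_left hdvd).mp h)
  rcases hcase with hodd | ⟨rfl, h2⟩
  · rw [← hbase]
    simpa using Int.emultiplicity_pow_sub_pow hp hodd (y := 1) (by rwa [hsub]) hunit j
  · have h4 : (4 : ℤ) ∣ (1 + ((2 : ℕ) : ℤ) ^ ν * a) - 1 := by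
      rw [hsub]
      exact (pow_dvd_pow (2 : ℤ) h2).mul_right _
    rw [← hbase, ← Int.natCast_emultiplicity 2 j]
    simpa using Int.two_pow_sub_pow' j h4 hunit

theorem lcsTimesPow_eq_zero_iff {p ν η : ℕ} (hp : p.Prime) (hν : 0 < ν)
    (hcase : Odd p ∨ (p = 2 ∧ 2 ≤ ν)) {a : ℕ} (ha : ¬ p ∣ a) (j : ℕ) :
    lcsTimesPow p ν (a : ZMod (p ^ η)) j = 0 ↔ p ^ η ∣ j := by
  obtain ⟨T, hT, hT'⟩ := exists_int_lcsTimesPow p ν (n := p ^ η) a j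
  have hpν : (p : ℤ) ^ ν ≠ 0 := pow_ne_zero _ (by exact_mod_cast hp.ne_zero)
  rw [hT, ZMod.intCast_zmod_eq_zero_iff_dvd, Nat.cast_pow, ← mul_dvd_mul_iff_left hpν, hT',
    ← pow_add, pow_dvd_iff_le_emultiplicity,
    emultiplicity_one_add_pow_mul_pow_sub_one hp hν hcase ha, Nat.cast_add,
    ENat.add_le_add_iff_left (ENat.natCast_ne_top ν), ← pow_dvd_iff_le_emultiplicity]

theorem lcsTimesPow_of_pow_eq_zero {p ν n : ℕ} (h : (p : ZMod n) ^ ν = 0) (x : ZMod n) (j : ℕ) :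
    lcsTimesPow p ν x j = j * x := by
  induction j with
  | zero => simp [lcsTimesPow]
  | succ j ih =>
    rw [lcsTimesPow, ih, lcsTimes, h]
    push_cast
    ring

theorem lcsTimesPow_self_eq_zero_iff {p ν : ℕ} (hp : p.Prime) {a : ℕ} (ha : ¬ p ∣ a) (j : ℕ) :
    lcsTimesPow p ν (a : ZMod (p ^ ν)) j = 0 ↔ p ^ ν ∣ j := by
  have h : (p : ZMod (p ^ ν)) ^ ν = 0 := by exact_mod_cast ZMod.natCast_self (p ^ ν)
  rw [lcsTimesPow_of_pow_eq_zero h, ← Nat.cast_mul, ZMod.natCast_eq_zero_iff,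
    (((hp.coprime_iff_not_dvd).mpr ha).pow_left ν).dvd_mul_right]

theorem isUnit_one_add_pow_mul {p ν η : ℕ} (hν : 0 < ν) (x : ZMod (p ^ η)) :
    IsUnit (1 + (p : ZMod (p ^ η)) ^ ν * x) := by
  have hnil : IsNilpotent (p : ZMod (p ^ η)) :=
    ⟨η, by exact_mod_cast ZMod.natCast_self (p ^ η)⟩
  exact ((Commute.all _ _).isNilpotent_mul_right (hnil.pow_of_pos hν.ne')).isUnit_one_add

theorem dvd_sub_of_lcsTimesPow_eq {p ν η : ℕ} (hν : 0 < ν) {x : ZMod (p ^ η)}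
    (hx : ∀ j, lcsTimesPow p ν x j = 0 → p ^ η ∣ j) {j k : ℕ} (hjk : j ≤ k)
    (h : lcsTimesPow p ν x j = lcsTimesPow p ν x k) : p ^ η ∣ k - j := by
  obtain ⟨m, rfl⟩ := Nat.exists_eq_add_of_le hjk
  rw [lcsTimesPow_add, left_eq_add, (isUnit_one_add_pow_mul hν _).mul_left_eq_zero] at h
  simpa using hx m h

theorem exists_lcsTimesPow_eq {p ν η : ℕ} (hp : p.Prime) (hν : 0 < ν) {x : ZMod (p ^ η)}
    (hx : ∀ j, lcsTimesPow p ν x j = 0 → p ^ η ∣ j) (h : ZMod (p ^ η)) :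
    ∃ j : ℕ, lcsTimesPow p ν x j = h := by
  have : NeZero (p ^ η) := ⟨pow_ne_zero _ hp.ne_zero⟩
  have hinj : Function.Injective fun y : ZMod (p ^ η) => lcsTimesPow p ν x y.val := by
    intro y z hyz
    wlog hle : y.val ≤ z.val generalizing y z
    · exact (this hyz.symm (le_of_not_ge hle)).symm
    have hzero := Nat.eq_zero_of_dvd_of_lt (dvd_sub_of_lcsTimesPow_eq hν hx hle hyz)
      ((Nat.sub_le _ _).trans_lt z.val_lt)
    exact ZMod.val_injective _ (by omega)
  obtain ⟨y, hy⟩ := Finite.surjective_of_injective hinj h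
  exact ⟨y.val, hy⟩

theorem stmt1 (p ν η : ℕ) (hp : p.Prime) (hν : 0 < ν) (hνη : ν ≤ η) (hη2 : η ≤ 2 * ν)
    (hcase : Odd p ∨ (p = 2 ∧ (ν, η) ≠ (1, 2)))
    (i : ZMod (p ^ η)) (hi : ¬ p ∣ i.val) :
    (∀ j : ℕ, lcsTimesPow p ν i j = 0 ↔ p ^ η ∣ j) ∧
      (∀ h : ZMod (p ^ η), ∃ j : ℕ, lcsTimesPow p ν i j = h) := by
  have : NeZero (p ^ η) := ⟨pow_ne_zero _ hp.ne_zero⟩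
  have hzero : ∀ j : ℕ, lcsTimesPow p ν i j = 0 ↔ p ^ η ∣ j := by
    intro j
    rw [← ZMod.natCast_zmod_val i]
    rcases hνη.eq_or_lt with rfl | hlt
    · exact lcsTimesPow_self_eq_zero_iff hp hi j
    · refine lcsTimesPow_eq_zero_iff hp hν (hcase.imp_right ?_) hi j
      rintro ⟨h2, hne⟩
      refine ⟨h2, ?_⟩
      by_contra hν2
      exact hne (Prod.ext (by dsimp only; omega) (by dsimp only; omega))
  exact ⟨hzero, exists_lcsTimesPow_eq hp hν fun j => (hzero j).mp⟩
end

section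
/- Assume p is odd, or p = 2 and η < 2ν. Then for all natural numbers l, l', m such that m ≡ l + l' − l·l'·p^ν (mod p^η), one has 1^{×l} + 1^{×l'} = 1^{×m} in H. -/
/-- If `p ^ ν = 2 * r` and `r * p ^ ν = 0`, then `1^{×j} = j + r j (j - 1)`. -/
theorem lcsTimesPow_one_eq (p ν : ℕ) {n : ℕ} (r : ZMod n) (h2 : (p : ZMod n) ^ ν = 2 * r)
    (h0 : r * (p : ZMod n) ^ ν = 0) (j : ℕ) :
    lcsTimesPow p ν (1 : ZMod n) j = j + r * j * (j - 1) := by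
  induction j with
  | zero => simp [lcsTimesPow]
  | succ j ih =>
    simp only [lcsTimesPow, lcsTimes, ih]
    push_cast
    linear_combination (j : ZMod n) * h2 + (j : ZMod n) * (j - 1) * h0

/-- The element `p ^ ν` of `ℤ/p^η ℤ` has a half which `p ^ ν` annihilates. -/
theorem exists_half_pow (p ν η : ℕ) (hν : 0 < ν) (hη2 : η ≤ 2 * ν)
    (hcase : Odd p ∨ (p = 2 ∧ η < 2 * ν)) :
    ∃ r : ZMod (p ^ η), (p : ZMod (p ^ η)) ^ ν = 2 * r ∧ r * (p : ZMod (p ^ η)) ^ ν = 0 := by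
  have hzero : (p : ZMod (p ^ η)) ^ η = 0 := by
    exact_mod_cast ZMod.natCast_self (p ^ η)
  rcases hcase with hodd | ⟨rfl, hlt⟩
  · obtain ⟨t, ht⟩ := hodd.pow (n := η)
    have ht' : (2 : ZMod (p ^ η)) * t + 1 = 0 := by
      rw [← hzero]
      exact_mod_cast congrArg (Nat.cast : ℕ → ZMod (p ^ η)) ht.symm
    have hsq : (p : ZMod (p ^ η)) ^ (2 * ν) = 0 := pow_eq_zero_of_le hη2 hzero
    refine ⟨-t * (p : ZMod (p ^ η)) ^ ν, ?_, ?_⟩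
    · linear_combination (p : ZMod (p ^ η)) ^ ν * ht'
    · rw [mul_assoc, ← pow_add, ← two_mul, hsq, mul_zero]
  · refine ⟨((2 : ℕ) : ZMod (2 ^ η)) ^ (ν - 1), ?_, ?_⟩
    · obtain ⟨k, rfl⟩ := Nat.exists_eq_succ_of_ne_zero hν.ne'
      simp [pow_succ']
    · rw [← pow_add]
      exact pow_eq_zero_of_le (by omega) hzero

theorem stmt2 (p ν η : ℕ) (hp : p.Prime) (hν : 0 < ν) (hνη : ν ≤ η) (hη2 : η ≤ 2 * ν)
    (hcase : Odd p ∨ (p = 2 ∧ η < 2 * ν))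
    (l l' m : ℕ)
    (hm : (m : ℤ) ≡ (l : ℤ) + (l' : ℤ) - (l : ℤ) * (l' : ℤ) * (p : ℤ) ^ ν [ZMOD (p : ℤ) ^ η]) :
    lcsTimesPow p ν (1 : ZMod (p ^ η)) l + lcsTimesPow p ν (1 : ZMod (p ^ η)) l' =
      lcsTimesPow p ν (1 : ZMod (p ^ η)) m := by
  obtain ⟨r, h2, h0⟩ := exists_half_pow p ν η hν hη2 hcase
  have hm' : (m : ZMod (p ^ η)) = l + l' - l * l' * (p : ZMod (p ^ η)) ^ ν := by
    have h := (ZMod.intCast_eq_intCast_iff _ _ (p ^ η)).2 (by exact_mod_cast hm)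
    exact_mod_cast h
  simp only [lcsTimesPow_one_eq p ν r h2 h0, hm']
  set q := (p : ZMod (p ^ η)) ^ ν
  linear_combination (l * l' : ZMod (p ^ η)) * h2 +
    (l * l' * (2 * (l + l') - 1 - l * l' * q) : ZMod (p ^ η)) * h0
end

section
/- Assume p = 2 and η = 2ν with ν > 1. Then for all natural numbers l, l', m such that m ≡ l + l' − l·l'·2^ν − l·l'·2^{2ν−1} (mod 2^η), one has 1^{×l} + 1^{×l'} = 1^{×m} in H. -/
theorem lcsTimesPow_one_eq_add_choose_two {p ν n : ℕ} (hq : ((p : ZMod n) ^ ν) ^ 2 = 0) (j : ℕ) :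
    lcsTimesPow p ν (1 : ZMod n) j = j + (p : ZMod n) ^ ν * (j.choose 2 : ℕ) := by
  induction j with
  | zero => simp [lcsTimesPow]
  | succ j ih =>
    rw [lcsTimesPow, ih, lcsTimes, Nat.choose_succ_succ' j 1, Nat.choose_one_right]
    push_cast
    linear_combination (j.choose 2 : ZMod n) * hq

theorem two_mul_cast_choose_two (j : ℕ) : 2 * (j.choose 2 : ℤ) = j * (j - 1) := by
  induction j with
  | zero => simp
  | succ j ih =>
    rw [Nat.choose_succ_succ' j 1, Nat.choose_one_right]
    push_cast
    linear_combination ih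

theorem stmt3 (p ν η : ℕ) (hp : p.Prime) (hν : 0 < ν) (hνη : ν ≤ η) (hη2 : η ≤ 2 * ν)
    (hp2 : p = 2) (hη : η = 2 * ν) (hν1 : 1 < ν)
    (l l' m : ℕ)
    (hm : (m : ℤ) ≡ (l : ℤ) + (l' : ℤ) - (l : ℤ) * (l' : ℤ) * 2 ^ ν
            - (l : ℤ) * (l' : ℤ) * 2 ^ (2 * ν - 1) [ZMOD (2 : ℤ) ^ η]) :
    lcsTimesPow p ν (1 : ZMod (p ^ η)) l + lcsTimesPow p ν (1 : ZMod (p ^ η)) l' =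
      lcsTimesPow p ν (1 : ZMod (p ^ η)) m := by
  subst hp2 hη
  obtain ⟨a, rfl⟩ : ∃ a, ν = a + 2 := ⟨ν - 2, by omega⟩
  have hq : (((2 : ℕ) : ZMod (2 ^ (2 * (a + 2)))) ^ (a + 2)) ^ 2 = 0 := by
    rw [← pow_mul, mul_comm (a + 2) 2, ← Nat.cast_pow, ZMod.natCast_self]
  simp only [lcsTimesPow_one_eq_add_choose_two hq]
  obtain ⟨k, hk⟩ := hm.dvd
  set g : ℤ := 2 ^ a with hg
  have hgν : (2 : ℤ) ^ (a + 2) = 4 * g := by rw [hg]; ring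
  have hgη : (2 : ℤ) ^ (2 * (a + 2)) = 16 * g ^ 2 := by rw [hg]; ring
  have hgη' : (2 : ℤ) ^ (2 * (a + 2) - 1) = 8 * g ^ 2 := by
    rw [show 2 * (a + 2) - 1 = 2 * a + 3 by omega, hg]; ring
  rw [hgν, hgη, hgη'] at hk
  have key : (m : ℤ) + 2 ^ (a + 2) * (m.choose 2 : ℕ) ≡
      (l + 2 ^ (a + 2) * (l.choose 2 : ℕ)) + (l' + 2 ^ (a + 2) * (l'.choose 2 : ℕ))
        [ZMOD ((2 ^ (2 * (a + 2)) : ℕ) : ℤ)] := by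
    rw [Int.modEq_iff_dvd]
    push_cast
    rw [hgν, hgη]
    obtain ⟨t, ht⟩ : ∃ t : ℤ, t = l * l' * (1 + 2 * g) + 4 * g * k := ⟨_, rfl⟩
    have hm' : (m : ℤ) = l + l' - 4 * g * t := by rw [ht]; linear_combination -hk
    have hcm := two_mul_cast_choose_two m
    rw [hm'] at hcm ⊢
    refine ⟨k + t * (l + l') - g * l * l' - 2 * g * k - 2 * g * t ^ 2,
      mul_left_cancel₀ (two_ne_zero (α := ℤ)) ?_⟩
    linear_combination 4 * g * two_mul_cast_choose_two l + 4 * g * two_mul_cast_choose_two l'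
      - 4 * g * hcm + (8 * g - 16 * g ^ 2) * ht
  have := (ZMod.intCast_eq_intCast_iff _ _ _).mpr key
  push_cast at this ⊢
  exact this.symm
end

section
/- Let A, B ∈ End(I) be such that p^η B = 0 and BA − AB = BAB + p^ν AB. Then for every natural number l, (A − AB)^l = A^l − (l + C(l,2)·p^ν)·(A^l B), where C(l,2) = l(l−1)/2. -/
theorem stmt4 (p ν η : ℕ) (hp : p.Prime) (hν : 0 < ν) (hνη : ν ≤ η) (hη2 : η ≤ 2 * ν)
    {I : Type*} [AddCommGroup I] (A B : Module.End ℤ I)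
    (hB : (p ^ η) • B = 0)
    (hcomm : B * A - A * B = B * A * B + (p ^ ν) • (A * B))
    (l : ℕ) :
    (A - A * B) ^ l = A ^ l - (l + l.choose 2 * p ^ ν) • (A ^ l * B) := by
  have h_sq : (p ^ ν * p ^ ν) • B = 0 := by
    rw [← pow_add, ← two_mul, ← Nat.sub_add_cancel hη2, pow_add, mul_smul, hB, smul_zero]
  have h_swap : B * (A - A * B) = (1 + p ^ ν) • (A * B) := by
    rw [mul_sub, ← mul_assoc, add_smul, one_smul, sub_eq_iff_eq_add, add_assoc, add_comm _ (B * A * B),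
      ← hcomm]
    abel
  induction l with
  | zero => simp
  | succ l ih =>
    have h_zero : (l.choose 2 * (p ^ ν * p ^ ν)) • (A ^ (l + 1) * B) = 0 := by
      rw [mul_smul, ← mul_smul_comm, h_sq, mul_zero, smul_zero]
    have h_coeff : (l + l.choose 2 * p ^ ν) * (1 + p ^ ν) + 1 =
        (l + 1 + (l + 1).choose 2 * p ^ ν) + l.choose 2 * (p ^ ν * p ^ ν) := by
      rw [Nat.choose_succ_succ' l 1, Nat.choose_one_right]
      ring
    have h_smul := congrArg (· • (A ^ (l + 1) * B)) h_coeff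
    simp only [add_smul _ (l.choose 2 * (p ^ ν * p ^ ν)), h_zero, add_zero] at h_smul
    rw [pow_succ, ih, ← h_smul, sub_mul, smul_mul_assoc, mul_assoc, h_swap, mul_smul_comm,
      ← mul_assoc, ← pow_succ, ← mul_smul, mul_sub, ← mul_assoc, ← pow_succ, add_smul, one_smul]
    abel
end

section
/- Let A, B ∈ End(I) be such that p^η B = 0 and BA − AB = BAB + p^ν AB. Then for every natural number l, B(A − AB)^l = (1 + l·p^ν)·(A^l B), and consequently (l + C(l,2)·p^ν)·(B A^l B) = B A^l − (1 + l·p^ν)·(A^l B), where C(l,2) = l(l−1)/2. -/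
section

variable {R : Type*} [Ring R] {A B : R} {q : ℕ}

theorem mul_sub_mul_pow_of_commutator_eq (hB : (q * q) • B = 0)
    (hcomm : B * A - A * B = B * A * B + q • (A * B)) (l : ℕ) :
    B * (A - A * B) ^ l = (1 + l * q) • (A ^ l * B) := by
  have h_step : B * (A - A * B) = (1 + q) • (A * B) := by
    calc B * (A - A * B) = (B * A - A * B) - B * A * B + A * B := by rw [mul_sub, mul_assoc]; abel
      _ = (1 + q) • (A * B) := by rw [hcomm, add_smul, one_smul]; abel
  have h_zero : ∀ X : R, (q * q) • (X * B) = 0 := fun X => by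
    rw [← mul_smul_comm, hB, mul_zero]
  induction l with
  | zero => simp
  | succ l ih =>
    rw [pow_succ', ← mul_assoc, h_step, smul_mul_assoc, mul_assoc, ih, mul_smul_comm,
      ← mul_assoc, ← pow_succ', smul_smul,
      show (1 + q) * (1 + l * q) = (1 + (l + 1) * q) + l * (q * q) by ring,
      add_smul _ (l * (q * q)), mul_smul l, h_zero, smul_zero, add_zero]

theorem pow_eq_sub_mul_pow_add_of_commutator_eq (hB : (q * q) • B = 0)
    (hcomm : B * A - A * B = B * A * B + q • (A * B)) (l : ℕ) :
    A ^ l = (A - A * B) ^ l + (l + l.choose 2 * q) • (A ^ l * B) := by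
  induction l with
  | zero => simp
  | succ l ih =>
    have h_coeff : l + 1 + (l + 1).choose 2 * q = (1 + l * q) + (l + l.choose 2 * q) := by
      rw [Nat.choose_succ_succ' l 1, Nat.choose_one_right]
      ring
    rw [h_coeff, add_smul, pow_succ' (A - A * B), sub_mul, mul_assoc A B,
      mul_sub_mul_pow_of_commutator_eq hB hcomm, mul_smul_comm, ← mul_assoc, ← pow_succ',
      ← add_assoc, sub_add_cancel, pow_succ', mul_assoc A, ← mul_smul_comm, ← mul_add, ← ih]

end

theorem stmt5 (p ν η : ℕ) (hp : p.Prime) (hν : 0 < ν) (hνη : ν ≤ η) (hη2 : η ≤ 2 * ν)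
    {I : Type*} [AddCommGroup I] (A B : Module.End ℤ I)
    (hB : (p ^ η) • B = 0)
    (hcomm : B * A - A * B = B * A * B + (p ^ ν) • (A * B))
    (l : ℕ) :
    B * (A - A * B) ^ l = (1 + l * p ^ ν) • (A ^ l * B) ∧
      (l + l.choose 2 * p ^ ν) • (B * A ^ l * B) =
        B * A ^ l - (1 + l * p ^ ν) • (A ^ l * B) := by
  have hB' : (p ^ ν * p ^ ν) • B = 0 := by
    rw [← pow_add, ← two_mul, ← Nat.sub_add_cancel hη2, pow_add, mul_smul, hB, smul_zero]
  have h_first := mul_sub_mul_pow_of_commutator_eq hB' hcomm l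
  refine ⟨h_first, ?_⟩
  rw [← h_first, ← mul_sub, mul_assoc, ← mul_smul_comm]
  congr 1
  exact eq_sub_of_add_eq' (pow_eq_sub_mul_pow_add_of_commutator_eq hB' hcomm l).symm
end

section
/- Assume p is odd, or p = 2 and (ν,η) ≠ (1,2). Let A, B ∈ End(I) be such that p^η B = 0 and BA − AB = BAB + p^ν AB. Then for every h ∈ H, A^{ℓ(h)}·(id − val(h)·B) = (A − AB)^{ℓ(h)} in End(I). -/
/-- The element `l(h) ∈ ℤ/p^η ℤ`, defined by `l(h) = h - C(val h, 2)·p^ν` if `p` is odd or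
`η < 2ν`, and `l(h) = h - C(val h, 2)·(2^ν + 2^(2ν-1))` if `p = 2` and `η = 2ν`. -/
def lcsL (p ν η : ℕ) (h : ZMod (p ^ η)) : ZMod (p ^ η) :=
  if p = 2 ∧ η = 2 * ν then
    h - (h.val.choose 2 : ZMod (p ^ η)) * ((2 : ZMod (p ^ η)) ^ ν + (2 : ZMod (p ^ η)) ^ (2 * ν - 1))
  else
    h - (h.val.choose 2 : ZMod (p ^ η)) * (p : ZMod (p ^ η)) ^ ν

theorem two_mul_intCast_choose_two (n : ℕ) : 2 * ((n.choose 2 : ℕ) : ℤ) = n * (n - 1) := by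
  induction n with
  | zero => simp
  | succ n ih =>
    rw [Nat.choose_succ_succ' n 1, Nat.choose_one_right]
    push_cast
    linarith

/-- If `BA - AB = BAB + qAB` and `q²B = 0`, then `(A - AB)^k = A^k (1 - (k + C(k,2) q) B)`. -/
theorem sub_mul_pow_eq_pow_mul_one_sub_smul {R : Type*} [Ring R] (A B : R) (q : ℕ)
    (hB : (q ^ 2) • B = 0) (hcomm : B * A - A * B = B * A * B + q • (A * B)) (k : ℕ) :
    (A - A * B) ^ k = A ^ k * (1 - (k + k.choose 2 * q) • B) := by
  induction k with
  | zero => simp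
  | succ k ih =>
    have hC : B * (A - A * B) = (1 + q) • (A * B) := by
      rw [mul_sub, ← mul_assoc, add_smul, one_smul, ← sub_eq_zero]
      rw [← sub_eq_zero] at hcomm
      rw [← hcomm]
      abel
    have hcoef : (1 + (k + k.choose 2 * q) * (1 + q)) • B
        = ((k + 1 : ℕ) + (k + 1).choose 2 * q) • B := by
      rw [Nat.choose_succ_succ' k 1, Nat.choose_one_right,
        show 1 + (k + k.choose 2 * q) * (1 + q)
          = (k + 1) + (k + k.choose (1 + 1)) * q + k.choose 2 * q ^ 2 by ring,
        add_smul, mul_smul (k.choose 2), hB, smul_zero, add_zero]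
    rw [pow_succ, ih, ← hcoef]
    generalize k + k.choose 2 * q = c
    calc A ^ k * (1 - c • B) * (A - A * B)
        = A ^ k * (A - A * B - c • (B * (A - A * B))) := by
          rw [mul_assoc, sub_mul, one_mul, smul_mul_assoc]
      _ = A ^ (k + 1) * (1 - (1 + c * (1 + q)) • B) := by
          rw [hC, ← mul_smul, pow_succ, mul_assoc, mul_sub A, mul_one, add_smul, one_smul,
            mul_add A, mul_smul_comm, sub_sub]

theorem dvd_add_choose_two_mul_sub {q N : ℤ} {k n : ℕ} (hqN : q ∣ N)
    (hN : ∀ x : ℤ, q ∣ 2 * x → N ∣ x * q) (hk : N ∣ k - (n - n.choose 2 * q)) :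
    N ∣ k + k.choose 2 * q - n := by
  have hK := two_mul_intCast_choose_two k
  have hn := two_mul_intCast_choose_two n
  have hkn : q ∣ (k : ℤ) - n := by
    have := (hqN.trans hk).sub (Dvd.intro_left ((n.choose 2 : ℕ) : ℤ) rfl)
    have e : (k : ℤ) - n
        = k - (n - n.choose 2 * q) - n.choose 2 * q := by ring
    rwa [e]
  have hx : N ∣ ((k.choose 2 : ℕ) - (n.choose 2 : ℕ) : ℤ) * q := by
    apply hN
    rw [show (2 : ℤ) * ((k.choose 2 : ℕ) - (n.choose 2 : ℕ)) = (k - n) * (k + n - 1) by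
      linear_combination hK - hn]
    exact hkn.mul_right _
  have e : (k : ℤ) + k.choose 2 * q - n
      = k - (n - n.choose 2 * q) + (k.choose 2 - n.choose 2) * q := by ring
  rw [e]
  exact hk.add hx

theorem four_mul_sq_dvd_add_choose_two_mul_sub {r : ℤ} {k n : ℕ} (hr : 2 ∣ r)
    (hk : 4 * r ^ 2 ∣ k - (n - n.choose 2 * (2 * r + 2 * r ^ 2))) :
    4 * r ^ 2 ∣ k + k.choose 2 * (2 * r) - n := by
  have hK := two_mul_intCast_choose_two k
  have hn := two_mul_intCast_choose_two n
  obtain ⟨s, hs⟩ := hr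
  obtain ⟨t, ht⟩ := hk
  generalize ((k.choose 2 : ℕ) : ℤ) = K at *
  generalize ((n.choose 2 : ℕ) : ℤ) = m at *
  have hk' : (k : ℤ) = n + 4 * r ^ 2 * t - m * (2 * r + 2 * r ^ 2) := by linear_combination ht
  rw [hk'] at hK ⊢
  have hKm : K = m + r * (2 * t * r - m * (1 + r)) *
      (2 * (n + 2 * t * r ^ 2 - m * r * (1 + r)) - 1) := by
    have h2 : (2 : ℤ) ≠ 0 := two_ne_zero
    apply mul_left_cancel₀ h2
    linear_combination hK - hn
  refine ⟨t + (2 * t * r - m * (1 + r)) * (n + 2 * t * r ^ 2 - m * r * (1 + r)) - t * r + m * s,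
    ?_⟩
  rw [hKm]
  linear_combination (2 * r ^ 2 * m) * hs

theorem intCast_dvd_lcsL_val_add_choose_two_mul_sub (p ν η : ℕ) (hp : p.Prime) (hν : 0 < ν)
    (hνη : ν ≤ η) (hη2 : η ≤ 2 * ν) (hcase : Odd p ∨ (p = 2 ∧ (ν, η) ≠ (1, 2)))
    (h : ZMod (p ^ η)) :
    ((p ^ η : ℕ) : ℤ) ∣ (lcsL p ν η h).val + (lcsL p ν η h).val.choose 2 * (p : ℤ) ^ ν - h.val := by
  have : NeZero (p ^ η) := ⟨pow_ne_zero _ hp.ne_zero⟩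
  have hval : (((lcsL p ν η h).val : ℤ) : ZMod (p ^ η)) = lcsL p ν η h := by simp
  generalize (lcsL p ν η h).val = k at *
  by_cases hc : p = 2 ∧ η = 2 * ν
  · obtain ⟨rfl, rfl⟩ := hc
    obtain ⟨μ, rfl⟩ : ∃ μ, ν = μ + 2 := by
      refine ⟨ν - 2, ?_⟩
      have : ν ≠ 1 := by
        rintro rfl
        simp [show ¬Odd 2 by decide] at hcase
      omega
    have hk : ((2 ^ (2 * (μ + 2)) : ℕ) : ℤ) ∣
        k - (h.val - h.val.choose 2 * (2 ^ (μ + 2) + 2 ^ (2 * (μ + 2) - 1))) := by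
      rw [← ZMod.intCast_eq_intCast_iff_dvd_sub, hval]
      simp [lcsL]
    have h4 : ((2 ^ (2 * (μ + 2)) : ℕ) : ℤ) = 4 * (2 ^ (μ + 1)) ^ 2 := by
      push_cast
      ring
    have h1 : (2 : ℤ) ^ (2 * (μ + 2) - 1) = 2 * (2 ^ (μ + 1)) ^ 2 := by
      rw [show 2 * (μ + 2) - 1 = 2 * (μ + 1) + 1 by omega]
      ring
    have h2 : (2 : ℤ) ^ (μ + 2) = 2 * 2 ^ (μ + 1) := by ring
    rw [h4, h1, h2] at hk
    push_cast at h4 ⊢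
    rw [h4, h2]
    exact four_mul_sq_dvd_add_choose_two_mul_sub (dvd_pow_self 2 (by omega)) hk
  · have hk : ((p ^ η : ℕ) : ℤ) ∣ k - (h.val - h.val.choose 2 * (p : ℤ) ^ ν) := by
      rw [← ZMod.intCast_eq_intCast_iff_dvd_sub, hval]
      simp [lcsL, hc]
    push_cast at hk ⊢
    refine dvd_add_choose_two_mul_sub (pow_dvd_pow _ hνη) ?_ hk
    intro x hx
    rcases hcase with hodd | ⟨rfl, -⟩
    · have hcop : IsCoprime ((p : ℤ) ^ ν) 2 := by
        apply IsCoprime.pow_left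
        exact_mod_cast Nat.isCoprime_iff_coprime.2 (Nat.coprime_two_right.2 hodd)
      refine (pow_dvd_pow _ hη2).trans ?_
      rw [two_mul, pow_add]
      exact mul_dvd_mul (hcop.dvd_of_dvd_mul_left hx) dvd_rfl
    · obtain ⟨μ, rfl⟩ : ∃ μ, ν = μ + 1 := ⟨ν - 1, by omega⟩
      have hx' : (2 : ℤ) ^ μ ∣ x := by
        push_cast at hx
        rw [pow_succ'] at hx
        exact (mul_dvd_mul_iff_left two_ne_zero).1 hx
      refine (pow_dvd_pow _ (show η ≤ μ + (μ + 1) by omega)).trans ?_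
      rw [pow_add]
      exact mul_dvd_mul (by exact_mod_cast hx') dvd_rfl

theorem stmt6 (p ν η : ℕ) (hp : p.Prime) (hν : 0 < ν) (hνη : ν ≤ η) (hη2 : η ≤ 2 * ν)
    (hcase : Odd p ∨ (p = 2 ∧ (ν, η) ≠ (1, 2)))
    {I : Type*} [AddCommGroup I] (A B : Module.End ℤ I)
    (hB : (p ^ η) • B = 0)
    (hcomm : B * A - A * B = B * A * B + (p ^ ν) • (A * B))
    (h : ZMod (p ^ η)) :
    A ^ (lcsL p ν η h).val * (1 - h.val • B) = (A - A * B) ^ (lcsL p ν η h).val := by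
  have hB2 : ((p ^ ν) ^ 2) • B = 0 := by
    rw [← pow_mul, show ν * 2 = (2 * ν - η) + η by omega, pow_add, mul_smul, hB, smul_zero]
  rw [sub_mul_pow_eq_pow_mul_one_sub_smul A B (p ^ ν) hB2 hcomm]
  congr 2
  obtain ⟨t, ht⟩ := intCast_dvd_lcsL_val_add_choose_two_mul_sub p ν η hp hν hνη hη2 hcase h
  rw [← natCast_zsmul B h.val, ← natCast_zsmul B (_ + _), eq_comm, ← sub_eq_zero, ← sub_smul]
  push_cast at ht ⊢
  rw [ht, mul_comm, mul_smul]
  have hBz : ((p : ℤ) ^ η) • B = 0 := by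
    rw [← hB, ← natCast_zsmul]
    push_cast
    rfl
  rw [hBz, smul_zero]
end

section
/- Let A, B ∈ End(I) be such that A^{p^η} = id and AB = BA. Then the two conditions p^η B = 0 and BA − AB = BAB + p^ν AB hold if and only if exactly one of the following mutually exclusive cases holds: (1) B = 0; (2) B ≠ 0, B² = 0 and p^ν B = 0; (3) B² ≠ 0, p^η B = 0, B³ = 0 and B² + p^ν B = 0. -/
theorem stmt7 (p ν η : ℕ) (hp : p.Prime) (hν : 0 < ν) (hνη : ν ≤ η) (hη2 : η ≤ 2 * ν)
    {I : Type*} [AddCommGroup I] (A B : Module.End ℤ I)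
    (hA : A ^ (p ^ η) = 1) (hAB : A * B = B * A) :
    ((p ^ η) • B = 0 ∧ B * A - A * B = B * A * B + (p ^ ν) • (A * B)) ↔
      (B = 0 ∨
        (B ≠ 0 ∧ B ^ 2 = 0 ∧ (p ^ ν) • B = 0) ∨
        (B ^ 2 ≠ 0 ∧ (p ^ η) • B = 0 ∧ B ^ 3 = 0 ∧ B ^ 2 + (p ^ ν) • B = 0)) := by
  have hunit : IsUnit A := IsUnit.of_pow_eq_one hA (pow_pos hp.pos η).ne'
  have hbracket : B * A - A * B = B * A * B + (p ^ ν) • (A * B) ↔ B ^ 2 + (p ^ ν) • B = 0 := by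
    have hfactor : B * A * B + (p ^ ν) • (A * B) = A * (B ^ 2 + (p ^ ν) • B) := by
      rw [← hAB, mul_add, mul_smul_comm, sq, mul_assoc]
    rw [hfactor, ← hAB, sub_self, eq_comm, hunit.mul_right_eq_zero]
  rw [hbracket]
  constructor
  · rintro ⟨hη, h⟩
    by_cases hB : B = 0
    · exact Or.inl hB
    by_cases hB2 : B ^ 2 = 0
    · exact Or.inr (Or.inl ⟨hB, hB2, by simpa [hB2] using h⟩)
    refine Or.inr (Or.inr ⟨hB2, hη, ?_, h⟩)
    have hsq : B ^ 2 = -((p ^ ν) • B) := eq_neg_of_add_eq_zero_left h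
    have hexp : p ^ ν * p ^ ν = p ^ (2 * ν - η) * p ^ η := by
      rw [← pow_add, ← pow_add]
      congr 1
      omega
    calc B ^ 3 = B ^ 2 * B := pow_succ B 2
      _ = -((p ^ ν) • B ^ 2) := by rw [hsq, neg_mul, smul_mul_assoc, ← sq, hsq]
      _ = (p ^ ν * p ^ ν) • B := by rw [hsq, smul_neg, neg_neg, mul_smul]
      _ = 0 := by rw [hexp, mul_smul, hη, smul_zero]
  · rintro (rfl | ⟨-, hB2, h⟩ | ⟨-, hη, -, h⟩)
    · simp
    · refine ⟨?_, by rw [hB2, h, add_zero]⟩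
      rw [← Nat.sub_add_cancel hνη, pow_add, mul_smul, h, smul_zero]
    · exact ⟨hη, h⟩
end

section
/- (a) For every map β : H × H → I that is symmetric, normalized (β(h,0) = β(0,h) = 0 for all h), and satisfies β(b,c) − β(a+b,c) + β(a,b+c) − β(a,b) = 0 for all a, b, c ∈ H, there exist γ ∈ I and a map φ : H → I with φ(0) = 0 such that β(h,h') = α₁(γ)(h,h') + φ(h) + φ(h') − φ(h+h') for all h, h' ∈ H. (b) For γ ∈ I, there exists a map φ : H → I with φ(0) = 0 such that α₁(γ)(h,h') = φ(h) + φ(h') − φ(h+h') for all h, h' ∈ H if and only if γ ∈ p^η I, i.e. γ = p^η·δ for some δ ∈ I. -/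
/-- `α₁(γ) : H × H → I`, where `H = ℤ/p^η ℤ`: it takes the value `γ` when
`val i + val j ≥ p^η` and `0` otherwise. -/
def alpha1 (p η : ℕ) {I : Type*} [AddCommGroup I] (γ : I) (i j : ZMod (p ^ η)) : I :=
  if p ^ η ≤ i.val + j.val then γ else 0

/-- A normalized 2-cocycle on `ZMod n` is determined by its values `β i 1`: on natural
representatives it is the coboundary of their partial sums. -/
lemma cocycle_eq_sum_range {n : ℕ} {I : Type*} [AddCommGroup I] (β : ZMod n → ZMod n → I)
    (h0 : ∀ h, β h 0 = 0)
    (hc : ∀ a b c, β b c - β (a + b) c + β a (b + c) - β a b = 0) (k m : ℕ) :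
    β k m = ∑ i ∈ Finset.range (k + m), β i 1 - ∑ i ∈ Finset.range k, β i 1
      - ∑ i ∈ Finset.range m, β i 1 := by
  induction m with
  | zero => simp [h0]
  | succ m ih =>
    have h := hc k m 1
    rw [ih] at h
    rw [← add_assoc, Finset.sum_range_succ, Finset.sum_range_succ]
    push_cast
    rw [← sub_eq_zero, ← h]
    abel

lemma ZMod.val_add_val_eq_val_add {n : ℕ} [NeZero n] (h h' : ZMod n) :
    h.val + h'.val = (if n ≤ h.val + h'.val then n else 0) + (h + h').val := by
  split_ifs with hle
  · rw [add_comm n, ZMod.val_add_val_of_le hle]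
  · rw [ZMod.val_add_of_lt (not_le.mp hle), zero_add]

lemma exists_carry_add_coboundary {n : ℕ} [NeZero n] {I : Type*} [AddCommGroup I]
    (β : ZMod n → ZMod n → I) (h0 : ∀ h, β h 0 = 0)
    (hc : ∀ a b c, β b c - β (a + b) c + β a (b + c) - β a b = 0) :
    ∃ (γ : I) (φ : ZMod n → I), φ 0 = 0 ∧ ∀ h h',
      β h h' = (if n ≤ h.val + h'.val then γ else 0) + φ h + φ h' - φ (h + h') := by
  refine ⟨∑ i ∈ Finset.range n, β i 1, fun h => -∑ i ∈ Finset.range h.val, β i 1,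
    by simp, fun h h' => ?_⟩
  have hβ := cocycle_eq_sum_range β h0 hc h.val h'.val
  have hn := cocycle_eq_sum_range β h0 hc (h + h').val n
  simp only [ZMod.natCast_self, h0, ZMod.natCast_zmod_val] at hβ hn
  rw [ZMod.val_add_val_eq_val_add h h'] at hβ
  beta_reduce
  rw [hβ]
  split_ifs with hle
  · rw [add_comm n, ← sub_eq_zero, hn]
    abel
  · rw [zero_add]
    abel

lemma carry_coboundary_iff {n : ℕ} (hn : 1 < n) {I : Type*} [AddCommGroup I] (γ : I) :
    (∃ φ : ZMod n → I, φ 0 = 0 ∧ ∀ h h',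
      (if n ≤ h.val + h'.val then γ else 0) = φ h + φ h' - φ (h + h')) ↔
      ∃ δ : I, γ = n • δ := by
  have : NeZero n := ⟨by omega⟩
  have : Fact (1 < n) := ⟨hn⟩
  constructor
  · rintro ⟨φ, hφ0, hφ⟩
    have hlin : ∀ k < n, φ (k : ZMod n) = k • φ 1 := by
      intro k
      induction k with
      | zero => simp [hφ0]
      | succ k ih =>
        intro hk
        have h := hφ k 1
        rw [ZMod.val_natCast_of_lt (by omega), ZMod.val_one, if_neg (by omega),
          ih (by omega)] at h
        rw [Nat.cast_succ, succ_nsmul]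
        exact (sub_eq_zero.mp h.symm).symm
    obtain ⟨m, rfl⟩ : ∃ m, n = m + 1 := ⟨n - 1, by omega⟩
    refine ⟨φ 1, ?_⟩
    have h := hφ m 1
    rwa [ZMod.val_natCast_of_lt (by omega), ZMod.val_one, if_pos le_rfl,
      hlin m (by omega), ← Nat.cast_succ, ZMod.natCast_self, hφ0, sub_zero,
      ← succ_nsmul] at h
  · rintro ⟨δ, rfl⟩
    refine ⟨fun h => h.val • δ, by simp, fun h h' => ?_⟩
    simp only
    rw [← add_nsmul, ZMod.val_add_val_eq_val_add h h', add_nsmul, add_sub_cancel_right,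
      ← ZMod.val_add_val_eq_val_add h h', ite_smul, zero_smul]

theorem stmt9 (p η : ℕ) (hp : p.Prime) (hη : 1 ≤ η) {I : Type*} [AddCommGroup I] :
    (∀ β : ZMod (p ^ η) → ZMod (p ^ η) → I,
      (∀ h h', β h h' = β h' h) →
      (∀ h, β h 0 = 0 ∧ β 0 h = 0) →
      (∀ a b c, β b c - β (a + b) c + β a (b + c) - β a b = 0) →
      ∃ (γ : I) (φ : ZMod (p ^ η) → I), φ 0 = 0 ∧
        ∀ h h', β h h' = alpha1 p η γ h h' + φ h + φ h' - φ (h + h')) ∧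
    (∀ γ : I,
      (∃ φ : ZMod (p ^ η) → I, φ 0 = 0 ∧
          ∀ h h', alpha1 p η γ h h' = φ h + φ h' - φ (h + h')) ↔
        ∃ δ : I, γ = (p ^ η) • δ) := by
  have : NeZero (p ^ η) := ⟨pow_ne_zero η hp.ne_zero⟩
  exact ⟨fun β _ h0 hc => exists_carry_add_coboundary β (fun h => (h0 h).1) hc,
    fun γ => carry_coboundary_iff (Nat.one_lt_pow (by omega) hp.one_lt) γ⟩
end

section
/- For every γ ∈ I and every b ∈ H: (i) α₁(γ)(b,1) = γ if b = p^η − 1 (the class of −1) and α₁(γ)(b,1) = 0 otherwise; (ii) α₁(γ)((1−p^ν)b, 1−p^ν) = γ if val((1−p^ν)b) ≥ p^ν − 1 and α₁(γ)((1−p^ν)b, 1−p^ν) = 0 otherwise; (iii) the set of b ∈ H with val((1−p^ν)b) ≥ p^ν − 1 has exactly p^η − p^ν + 1 elements. -/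
theorem ZMod.natCard_le_val (n k : ℕ) [NeZero n] :
    Nat.card {x : ZMod n // k ≤ x.val} = n - k := by
  rw [← Nat.card_Ico k n, ← Nat.card_eq_finsetCard]
  exact Nat.card_congr
    { toFun := fun x => ⟨x.1.val, Finset.mem_Ico.2 ⟨x.2, x.1.val_lt⟩⟩
      invFun := fun m => ⟨(m.1 : ZMod n), by
        rw [ZMod.val_natCast_of_lt (Finset.mem_Ico.1 m.2).2]
        exact (Finset.mem_Ico.1 m.2).1⟩
      left_inv := fun x => Subtype.ext (ZMod.natCast_zmod_val x.1)
      right_inv := fun m => Subtype.ext (ZMod.val_natCast_of_lt (Finset.mem_Ico.1 m.2).2) }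

theorem ZMod.natCard_le_val_mul {n : ℕ} [NeZero n] (k : ℕ) {u : ZMod n} (hu : IsUnit u) :
    Nat.card {x : ZMod n // k ≤ (u * x).val} = n - k := by
  rw [← ZMod.natCard_le_val n k]
  obtain ⟨v, rfl⟩ := hu
  exact Nat.card_congr ((Units.mulLeft v).subtypeEquiv fun x => Iff.rfl)

theorem ZMod.eq_neg_one_iff_le_val_add_one {n : ℕ} [NeZero n] (b : ZMod n) :
    b = -1 ↔ n ≤ b.val + 1 := by
  have hlt := b.val_lt
  rw [eq_neg_iff_add_eq_zero]
  have hcast : b + 1 = ((b.val + 1 : ℕ) : ZMod n) := by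
    rw [Nat.cast_add, ZMod.natCast_zmod_val, Nat.cast_one]
  rw [hcast, ZMod.natCast_eq_zero_iff]
  constructor
  · exact Nat.le_of_dvd (Nat.succ_pos _)
  · intro h
    rw [show b.val + 1 = n by omega]

theorem ZMod.val_one_sub_natCast {n m : ℕ} (hm : 2 ≤ m) (hmn : m ≤ n) :
    (1 - (m : ZMod n)).val = n - m + 1 := by
  have hcast : 1 - (m : ZMod n) = ((n - m + 1 : ℕ) : ZMod n) := by
    rw [Nat.cast_add, Nat.cast_sub hmn, ZMod.natCast_self, Nat.cast_one]
    ring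
  rw [hcast, ZMod.val_natCast_of_lt (by omega)]

theorem stmt10 (p ν η : ℕ) (hp : p.Prime) (hν : 0 < ν) (hνη : ν ≤ η) (hη2 : η ≤ 2 * ν)
    {I : Type*} [AddCommGroup I] (γ : I) (b : ZMod (p ^ η)) :
    (alpha1 p η γ b 1 = if b = -1 then γ else 0) ∧
    (alpha1 p η γ ((1 - (p : ZMod (p ^ η)) ^ ν) * b) (1 - (p : ZMod (p ^ η)) ^ ν) =
      if p ^ ν - 1 ≤ ((1 - (p : ZMod (p ^ η)) ^ ν) * b).val then γ else 0) ∧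
    Nat.card {b' : ZMod (p ^ η) // p ^ ν - 1 ≤ ((1 - (p : ZMod (p ^ η)) ^ ν) * b').val} =
      p ^ η - p ^ ν + 1 := by
  have : NeZero (p ^ η) := ⟨pow_ne_zero _ hp.ne_zero⟩
  have hle : p ^ ν ≤ p ^ η := Nat.pow_le_pow_right hp.pos hνη
  have htwo : 2 ≤ p ^ ν := hp.two_le.trans (Nat.le_self_pow hν.ne' p)
  have hval : (1 - (p : ZMod (p ^ η)) ^ ν).val = p ^ η - p ^ ν + 1 := by
    rw [← Nat.cast_pow]
    exact ZMod.val_one_sub_natCast htwo hle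
  have hone : (1 : ZMod (p ^ η)).val = 1 := ZMod.val_one'' (by omega)
  have hunit : IsUnit (1 - (p : ZMod (p ^ η)) ^ ν) := by
    refine IsNilpotent.isUnit_one_sub ⟨2, ?_⟩
    rw [← pow_mul, mul_comm, ← Nat.cast_pow, ZMod.natCast_eq_zero_iff]
    exact pow_dvd_pow p hη2
  refine ⟨?_, ?_, ?_⟩
  · simp only [alpha1, hone, ZMod.eq_neg_one_iff_le_val_add_one]
  · rw [alpha1, hval]
    exact if_congr (by omega) rfl rfl
  · rw [ZMod.natCard_le_val_mul _ hunit]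
    omega
end

section
/- Assume p is odd, or p = 2 and (ν,η) ≠ (1,2). Let A ∈ End(I) with A^{p^η} = id, let γ ∈ I, and let f : H × H → I satisfy f(h,0) = f(0,h) = 0 for all h and, for all a, b, c ∈ H, f(a, b+c) − f(a,b) − f(a,c) = A^{ℓ(a)}(α₁(γ)(b,c)) − α₁(γ)(a·b, a·c) and f(a+b, c) = A^{ℓ(a·b)}(f(a,c)) + f(a·b, a·c). Then there exists a map t : H → I with t(0) = 0 such that α₁(γ)(h,h') = t(h) + t(h') − t(h+h') for all h, h' ∈ H and f(a,b) = t(a·b) − A^{ℓ(a)}(t(b)) for all a, b ∈ H, if and only if there exists t₀ ∈ I such that f(1,1) = (p^η − p^ν + 1)·t₀ − A(t₀) and γ = p^η·t₀. -/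
/-- The cycle set operation `i · j := (1 − p^ν i) j`. -/
def lcsDot (p ν : ℕ) {n : ℕ} (i j : ZMod n) : ZMod n :=
  (1 - (p : ZMod n) ^ ν * i) * j

theorem natCast_pow_mul_self {p ν η : ℕ} (hη2 : η ≤ 2 * ν) :
    (p : ZMod (p ^ η)) ^ ν * (p : ZMod (p ^ η)) ^ ν = 0 := by
  have h0 : (p : ZMod (p ^ η)) ^ η = 0 := by exact_mod_cast ZMod.natCast_self (p ^ η)
  rw [← pow_add]
  exact pow_eq_zero_of_le (by omega) h0

/-- The map `lcsL` is quadratic: `l(h) = h - w h (h - 1)` for a nilpotent `w` with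
`2 w = p ^ ν + w p ^ ν` and `2 w p ^ ν = 0`. -/
theorem exists_lcsL_eq_quadratic {p ν η : ℕ} (hp : p.Prime) (hν : 0 < ν) (hνη : ν ≤ η)
    (hη2 : η ≤ 2 * ν) (hcase : Odd p ∨ (p = 2 ∧ (ν, η) ≠ (1, 2))) :
    ∃ w : ZMod (p ^ η), IsNilpotent w ∧ (∀ h, lcsL p ν η h = h - w * (h * (h - 1))) ∧
      2 * w = (p : ZMod (p ^ η)) ^ ν + w * (p : ZMod (p ^ η)) ^ ν ∧
      2 * (w * (p : ZMod (p ^ η)) ^ ν) = 0 := by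
  have hzero : ∀ k, η ≤ k → (p : ZMod (p ^ η)) ^ k = 0 := fun k hk => by
    have h0 : (p : ZMod (p ^ η)) ^ η = 0 := by exact_mod_cast ZMod.natCast_self (p ^ η)
    exact pow_eq_zero_of_le hk h0
  have hpn : IsNilpotent (p : ZMod (p ^ η)) := ⟨η, hzero η le_rfl⟩
  have hchoose : ∀ h : ZMod (p ^ η), 2 * (h.val.choose 2 : ZMod (p ^ η)) = h * (h - 1) := by
    intro h
    have : NeZero (p ^ η) := ⟨pow_ne_zero _ hp.ne_zero⟩
    obtain ⟨n, rfl⟩ : ∃ n : ℕ, (n : ZMod (p ^ η)) = h := ⟨h.val, ZMod.natCast_zmod_val h⟩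
    generalize hm : (n : ZMod (p ^ η)).val = m
    have hnm : (n : ZMod (p ^ η)) = m := by rw [← hm, ZMod.natCast_zmod_val]
    rw [hnm]
    clear hm hnm
    induction m with
    | zero => simp
    | succ k ih =>
      rw [Nat.choose_succ_succ' k 1, Nat.choose_one_right]
      push_cast
      linear_combination ih
  have hqq := natCast_pow_mul_self (p := p) hη2
  rcases hcase with hodd | ⟨rfl, hne⟩
  · have hp2 : p ≠ 2 := by rintro rfl; exact absurd hodd (by decide)
    have h2 : ((2 : ZMod (p ^ η))) * (2 : ZMod (p ^ η))⁻¹ = 1 := by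
      have := ZMod.coe_mul_inv_eq_one (n := p ^ η) 2
        (Nat.Coprime.pow_right _ (Nat.coprime_two_left.mpr hodd))
      exact_mod_cast this
    refine ⟨(2 : ZMod (p ^ η))⁻¹ * (p : ZMod (p ^ η)) ^ ν, ?_, fun h => ?_, ?_, ?_⟩
    · exact (Commute.all _ _).isNilpotent_mul_left (hpn.pow_of_pos hν.ne')
    · rw [lcsL, if_neg (fun h => hp2 h.1), ← hchoose h]
      linear_combination (h.val.choose 2 : ZMod (p ^ η)) * (p : ZMod (p ^ η)) ^ ν * h2
    · linear_combination (p : ZMod (p ^ η)) ^ ν * h2 - (2 : ZMod (p ^ η))⁻¹ * hqq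
    · linear_combination 2 * (2 : ZMod (p ^ η))⁻¹ * hqq
  · simp only [Nat.cast_ofNat] at *
    rcases Nat.lt_or_ge 1 ν with h1 | h1
    · obtain ⟨m, rfl⟩ : ∃ m, ν = m + 2 := ⟨ν - 2, by omega⟩
      rcases hη2.lt_or_eq with hlt | heq
      · refine ⟨2 ^ (m + 1), hpn.pow_of_pos (by omega), fun h => ?_, ?_, ?_⟩
        · rw [lcsL, if_neg (by omega), ← hchoose h, Nat.cast_ofNat]
          ring
        · linear_combination - hzero (m + 1 + (m + 2)) (by omega)
        · linear_combination 2 * hzero (m + 1 + (m + 2)) (by omega)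
      · refine ⟨2 ^ (m + 1) + 2 ^ (2 * m + 2), ?_, fun h => ?_, ?_, ?_⟩
        · exact (Commute.all _ _).isNilpotent_add (hpn.pow_of_pos (by omega))
            (hpn.pow_of_pos (by omega))
        · rw [lcsL, if_pos ⟨rfl, heq⟩, ← hchoose h,
            show 2 * (m + 2) - 1 = 2 * m + 3 by omega]
          ring
        · linear_combination - hzero (2 * m + 2 + (m + 2)) (by omega)
        · linear_combination hzero (2 * (m + 2)) (by omega) +
            2 * hzero (2 * m + 2 + (m + 2)) (by omega)
    · obtain rfl : ν = 1 := by omega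
      obtain rfl : η = 1 := by
        have : η ≠ 2 := fun h => hne (by rw [h])
        omega
      exact ⟨0, IsNilpotent.zero, by decide, by decide, by decide⟩

/-- `l` is a 1-cocycle: `l(a + b) = l(a) + l(a · b)`. -/
theorem lcsL_add {p ν η : ℕ} (hp : p.Prime) (hν : 0 < ν) (hνη : ν ≤ η)
    (hη2 : η ≤ 2 * ν) (hcase : Odd p ∨ (p = 2 ∧ (ν, η) ≠ (1, 2))) (a b : ZMod (p ^ η)) :
    lcsL p ν η (a + b) = lcsL p ν η a + lcsL p ν η (lcsDot p ν a b) := by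
  obtain ⟨w, -, hl, h2w, h2wq⟩ := exists_lcsL_eq_quadratic hp hν hνη hη2 hcase
  have hqq := natCast_pow_mul_self (p := p) hη2
  simp only [hl, lcsDot]
  linear_combination (-(a * b)) * h2w - b * (a * b) * h2wq + w * (a * b) ^ 2 * hqq

theorem eq_zero_of_lcsL_eq_zero {p ν η : ℕ} (hp : p.Prime) (hν : 0 < ν) (hνη : ν ≤ η)
    (hη2 : η ≤ 2 * ν) (hcase : Odd p ∨ (p = 2 ∧ (ν, η) ≠ (1, 2))) {h : ZMod (p ^ η)}
    (hh : lcsL p ν η h = 0) : h = 0 := by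
  obtain ⟨w, hw, hl, -, -⟩ := exists_lcsL_eq_quadratic hp hν hνη hη2 hcase
  have hu : IsUnit (1 - w * (h - 1)) :=
    ((Commute.all _ _).isNilpotent_mul_right hw).isUnit_one_sub
  refine hu.mul_left_eq_zero.mp ?_
  rw [hl] at hh
  linear_combination hh

theorem lcsL_one {p ν η : ℕ} [Fact (1 < p ^ η)] : lcsL p ν η 1 = 1 := by
  simp [lcsL, ZMod.val_one]

theorem lcsDot_add_left {p ν η : ℕ} (hη2 : η ≤ 2 * ν) (a b c : ZMod (p ^ η)) :
    lcsDot p ν (a + b) c = lcsDot p ν (lcsDot p ν a b) (lcsDot p ν a c) := by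
  have hqq := natCast_pow_mul_self (p := p) hη2
  simp only [lcsDot]
  linear_combination (-(2 * a * b * c) + (p : ZMod (p ^ η)) ^ ν * a ^ 2 * b * c) * hqq

theorem lcsDot_add_right {p ν n : ℕ} (a b c : ZMod n) :
    lcsDot p ν a (b + c) = lcsDot p ν a b + lcsDot p ν a c := by
  simp only [lcsDot]
  ring

/-- A subset of `ℤ/p^η ℤ` containing `0` and closed under `b ↦ 1 × b` is everything. This is
stated through the inverse of that map, `h ↦ 1 · (h - 1)`. -/
theorem lcs_induction {p ν η : ℕ} (hp : p.Prime) (hν : 0 < ν) (hνη : ν ≤ η)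
    (hη2 : η ≤ 2 * ν) (hcase : Odd p ∨ (p = 2 ∧ (ν, η) ≠ (1, 2)))
    {P : ZMod (p ^ η) → Prop} (zero : P 0) (step : ∀ b, P (lcsDot p ν 1 b) → P (1 + b))
    (h : ZMod (p ^ η)) : P h := by
  have : Fact (1 < p ^ η) := ⟨Nat.one_lt_pow (by omega) hp.one_lt⟩
  have key : ∀ (j : ℕ) (h : ZMod (p ^ η)), lcsL p ν η h = j → P h := by
    intro j
    induction j with
    | zero =>
      intro h hh
      rw [eq_zero_of_lcsL_eq_zero hp hν hνη hη2 hcase (hh.trans Nat.cast_zero)]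
      exact zero
    | succ j ih =>
      intro h hh
      have := step (h - 1) (ih _ ?_)
      · rwa [add_sub_cancel] at this
      · have hadd := lcsL_add hp hν hνη hη2 hcase 1 (h - 1)
        rw [add_sub_cancel, hh, lcsL_one] at hadd
        push_cast at hadd
        linear_combination -hadd
  exact key _ h (ZMod.natCast_zmod_val _).symm

/-- The multiples of `t₀` trivialise `α₁(p^η t₀)`. -/
theorem alpha1_nsmul_eq {p η : ℕ} [NeZero (p ^ η)] {I : Type*} [AddCommGroup I] (t₀ : I)
    (h h' : ZMod (p ^ η)) :
    alpha1 p η ((p ^ η) • t₀) h h' = h.val • t₀ + h'.val • t₀ - (h + h').val • t₀ := by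
  rw [alpha1, eq_sub_iff_add_eq]
  split_ifs with hle
  · rw [ZMod.val_add_of_le hle, ← add_nsmul, ← add_nsmul, Nat.add_sub_cancel' hle]
  · rw [ZMod.val_add_of_lt (not_le.mp hle), add_nsmul, zero_add]

/-- Any normalised trivialisation of `α₁(γ)` is given by the multiples of its value at `1`. -/
theorem eq_nsmul_of_alpha1_eq {p η : ℕ} [Fact (1 < p ^ η)] {I : Type*} [AddCommGroup I] {γ : I}
    {t : ZMod (p ^ η) → I} (ht0 : t 0 = 0)
    (ht : ∀ h h' : ZMod (p ^ η), alpha1 p η γ h h' = t h + t h' - t (h + h')) :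
    (∀ h, t h = h.val • t 1) ∧ γ = (p ^ η) • t 1 := by
  have h1 : 1 < p ^ η := Fact.out
  have : NeZero (p ^ η) := ⟨by omega⟩
  have hnat : ∀ k < p ^ η, t (k : ZMod (p ^ η)) = k • t 1 := by
    intro k
    induction k with
    | zero => simp [ht0]
    | succ k ih =>
      intro hk
      have := ht k 1
      rw [alpha1, if_neg (by rw [ZMod.val_natCast_of_lt (by omega), ZMod.val_one]; omega),
        ih (by omega)] at this
      rw [Nat.cast_succ, succ_nsmul]
      exact (sub_eq_zero.mp this.symm).symm
  refine ⟨fun h => ?_, ?_⟩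
  · conv_lhs => rw [← ZMod.natCast_zmod_val h]
    exact hnat _ h.val_lt
  · have := ht ((p ^ η - 1 : ℕ) : ZMod (p ^ η)) 1
    rwa [alpha1, if_pos (by rw [ZMod.val_natCast_of_lt (by omega), ZMod.val_one]; omega),
      hnat _ (by omega), ← Nat.cast_succ, Nat.succ_eq_add_one, Nat.sub_add_cancel h1.le,
      ZMod.natCast_self, ht0, sub_zero, ← succ_nsmul, Nat.sub_add_cancel h1.le] at this

theorem val_lcsDot_one_one {p ν η : ℕ} (hp : p.Prime) (hν : 0 < ν) (hνη : ν ≤ η) :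
    (lcsDot p ν (1 : ZMod (p ^ η)) 1).val = p ^ η - p ^ ν + 1 := by
  have hle : p ^ ν ≤ p ^ η := Nat.pow_le_pow_right hp.pos hνη
  have h1 : 1 < p ^ ν := Nat.one_lt_pow (by omega) hp.one_lt
  have hcast : lcsDot p ν (1 : ZMod (p ^ η)) 1 = ((p ^ η - p ^ ν + 1 : ℕ) : ZMod (p ^ η)) := by
    have h0 : (p : ZMod (p ^ η)) ^ η = 0 := by exact_mod_cast ZMod.natCast_self (p ^ η)
    rw [Nat.cast_add, Nat.cast_sub hle]
    push_cast
    rw [h0, lcsDot]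
    ring
  rw [hcast, ZMod.val_natCast_of_lt (by omega)]

theorem stmt17 (p ν η : ℕ) (hp : p.Prime) (hν : 0 < ν) (hνη : ν ≤ η) (hη2 : η ≤ 2 * ν)
    (hcase : Odd p ∨ (p = 2 ∧ (ν, η) ≠ (1, 2)))
    {I : Type*} [AddCommGroup I] (A : Module.End ℤ I) (hA : A ^ (p ^ η) = 1) (γ : I)
    (f : ZMod (p ^ η) → ZMod (p ^ η) → I)
    (hnorm : ∀ h : ZMod (p ^ η), f h 0 = 0 ∧ f 0 h = 0)
    (hcoc1 : ∀ a b c : ZMod (p ^ η),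
      f a (b + c) - f a b - f a c =
        (A ^ (lcsL p ν η a).val) (alpha1 p η γ b c) -
          alpha1 p η γ (lcsDot p ν a b) (lcsDot p ν a c))
    (hcoc2 : ∀ a b c : ZMod (p ^ η),
      f (a + b) c =
        (A ^ (lcsL p ν η (lcsDot p ν a b)).val) (f a c) +
          f (lcsDot p ν a b) (lcsDot p ν a c)) :
    (∃ t : ZMod (p ^ η) → I, t 0 = 0 ∧
        (∀ h h' : ZMod (p ^ η), alpha1 p η γ h h' = t h + t h' - t (h + h')) ∧
        (∀ a b : ZMod (p ^ η), f a b = t (lcsDot p ν a b) - (A ^ (lcsL p ν η a).val) (t b))) ↔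
      ∃ t₀ : I, f 1 1 = (p ^ η - p ^ ν + 1) • t₀ - A t₀ ∧ γ = (p ^ η) • t₀ := by
  have : Fact (1 < p ^ η) := ⟨Nat.one_lt_pow (by omega) hp.one_lt⟩
  have : NeZero (p ^ η) := ⟨pow_ne_zero _ hp.ne_zero⟩
  have hval := val_lcsDot_one_one hp hν hνη
  constructor
  · rintro ⟨t, ht0, htα, htf⟩
    obtain ⟨ht, hγ⟩ := eq_nsmul_of_alpha1_eq ht0 htα
    refine ⟨t 1, ?_, hγ⟩
    rw [htf, lcsL_one, ZMod.val_one, pow_one, ht (lcsDot p ν 1 1), hval]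
  · rintro ⟨t₀, hf, rfl⟩
    refine ⟨fun h => h.val • t₀, by simp, alpha1_nsmul_eq t₀, ?_⟩
    refine lcs_induction hp hν hνη hη2 hcase (fun b => ?_) (fun b ih c => ?_)
    · simp [(hnorm b).2, lcsDot, lcsL]
    · have hone : ∀ c, f 1 c = (lcsDot p ν 1 c).val • t₀ - A (c.val • t₀) := by
        intro c
        obtain ⟨n, rfl⟩ : ∃ n : ℕ, (n : ZMod (p ^ η)) = c := ⟨c.val, ZMod.natCast_zmod_val c⟩
        induction n with
        | zero => simp [(hnorm 1).1, lcsDot]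
        | succ n ih =>
          have h1 := hcoc1 1 n 1
          rw [lcsL_one, ZMod.val_one, pow_one, alpha1_nsmul_eq, alpha1_nsmul_eq, ih, hf,
            ← lcsDot_add_right, hval, map_sub, map_add, ZMod.val_one, one_nsmul] at h1
          rw [Nat.cast_succ]
          rw [← sub_eq_zero] at h1 ⊢
          rw [← h1]
          abel
      have hA' : A ^ (lcsL p ν η (1 + b)).val = A ^ (lcsL p ν η (lcsDot p ν 1 b)).val * A := by
        rw [lcsL_add hp hν hνη hη2 hcase, lcsL_one, ZMod.val_add, ← pow_eq_pow_mod _ hA,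
          ZMod.val_one, add_comm, pow_succ]
      rw [hcoc2, hone, ih, lcsDot_add_left hη2, hA', map_sub, Module.End.mul_apply]
      abel
end

section
/- Let p be an odd prime, let r ≥ 1 and η ≥ 1 be natural numbers, let a be a natural number with 0 ≤ a < p^r, and set η₀ := min(r−1, η). Then the following are equivalent: (1) a^{p^η} ≡ 1 (mod p^r); (2) a^{p^{η₀}} ≡ 1 (mod p^r); (3) a ≡ 1 (mod p^{r−η₀}). -/
/-- For an odd prime `p` and `1 ≤ r`, the power `x ^ p ^ k` is `1` modulo `p ^ r` exactly when `x`
is `1` modulo `p ^ max 1 (r - k)`, the exponent being written as `r - min (r - 1) k`. -/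
theorem Int.pow_prime_pow_modEq_one_iff {p : ℕ} (hp : p.Prime) (hodd : Odd p) {r : ℕ}
    (hr : 1 ≤ r) (k : ℕ) (x : ℤ) :
    x ^ p ^ k ≡ 1 [ZMOD (p : ℤ) ^ r] ↔ x ≡ 1 [ZMOD (p : ℤ) ^ (r - min (r - 1) k)] := by
  have : Fact p.Prime := ⟨hp⟩
  have fermat : (p : ℤ) ∣ x ^ p ^ k - 1 ↔ (p : ℤ) ∣ x - 1 := by
    rw [← ZMod.intCast_zmod_eq_zero_iff_dvd, ← ZMod.intCast_zmod_eq_zero_iff_dvd]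
    push_cast
    rw [ZMod.pow_card_pow]
  rw [Int.modEq_comm, Int.modEq_iff_dvd, Int.modEq_comm, Int.modEq_iff_dvd]
  by_cases h : (p : ℤ) ∣ x - 1
  · have hx : ¬ (p : ℤ) ∣ x := fun hx =>
      (Nat.prime_iff_prime_int.1 hp).not_dvd_one (by simpa using dvd_sub hx h)
    have lte := Int.emultiplicity_pow_sub_pow hp hodd h hx (p ^ k)
    rw [one_pow, emultiplicity_pow_self hp.ne_zero hp.prime.not_isUnit] at lte
    have he : ((1 : ℕ) : ℕ∞) ≤ emultiplicity (p : ℤ) (x - 1) :=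
      pow_dvd_iff_le_emultiplicity.1 (by simpa using h)
    rw [pow_dvd_iff_le_emultiplicity, pow_dvd_iff_le_emultiplicity, lte]
    generalize emultiplicity (p : ℤ) (x - 1) = e at he
    cases e with
    | top => simp
    | coe e =>
      norm_cast at he ⊢
      omega
  · exact iff_of_false
      (fun h' => h (fermat.1 ((dvd_pow_self _ (by omega)).trans h')))
      (fun h' => h ((dvd_pow_self _ (by omega)).trans h'))

theorem stmt18 (p : ℕ) (hp : p.Prime) (hodd : Odd p) (r η : ℕ) (hr : 1 ≤ r) (hη : 1 ≤ η)
    (a : ℕ) (ha : a < p ^ r) :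
    ((a : ℤ) ^ (p ^ η) ≡ 1 [ZMOD (p : ℤ) ^ r] ↔
        (a : ℤ) ^ (p ^ (min (r - 1) η)) ≡ 1 [ZMOD (p : ℤ) ^ r]) ∧
    ((a : ℤ) ^ (p ^ (min (r - 1) η)) ≡ 1 [ZMOD (p : ℤ) ^ r] ↔
        (a : ℤ) ≡ 1 [ZMOD (p : ℤ) ^ (r - min (r - 1) η)]) := by
  have hmin : min (r - 1) (min (r - 1) η) = min (r - 1) η := by omega
  rw [Int.pow_prime_pow_modEq_one_iff hp hodd hr η,
    Int.pow_prime_pow_modEq_one_iff hp hodd hr (min (r - 1) η), hmin]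
  exact ⟨Iff.rfl, Iff.rfl⟩
end

section
/- Let r > 2 and η ≥ 1 be natural numbers, let a be a natural number with 0 ≤ a < 2^r, and set η₀ := min(r−2, η). Then the following are equivalent: (1) a^{2^η} ≡ 1 (mod 2^r); (2) a^{2^{η₀}} ≡ 1 (mod 2^r); (3) a² ≡ 1 (mod 2^{r+1−η₀}). -/
theorem two_pow_add_dvd_pow_two_pow_sub_one_iff {a : ℤ} (ha : Odd a) (n k : ℕ) :
    (2 : ℤ) ^ (n + k) ∣ a ^ (2 ^ (k + 1)) - 1 ↔ (2 : ℤ) ^ n ∣ a ^ 2 - 1 := by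
  induction k with
  | zero => simp
  | succ k ih =>
    rw [← ih]
    have hb : Odd (a ^ 2 ^ k) := ha.pow
    obtain ⟨c, hc⟩ : ∃ c : ℤ, a ^ 2 ^ (k + 1) + 1 = 2 * c ∧ Odd c := by
      obtain ⟨d, hd⟩ := hb
      refine ⟨2 * (d ^ 2 + d) + 1, ?_, _, rfl⟩
      rw [pow_succ 2 k, pow_mul, hd]
      ring
    have hfac : a ^ 2 ^ (k + 1 + 1) - 1 = 2 * ((a ^ 2 ^ (k + 1) - 1) * c) := by
      rw [pow_succ 2 (k + 1), pow_mul]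
      linear_combination (a ^ 2 ^ (k + 1) - 1) * hc.1
    have hcop : IsCoprime ((2 : ℤ) ^ (n + k)) c :=
      (Int.isCoprime_two_left.mpr hc.2).pow_left
    rw [hfac, ← add_assoc, pow_succ', mul_dvd_mul_iff_left two_ne_zero]
    exact ⟨hcop.dvd_of_dvd_mul_right, fun h => h.mul_right c⟩

theorem two_pow_dvd_pow_two_pow_sub_one {a : ℤ} (ha : Odd a) {r m : ℕ} (hm : 1 ≤ m)
    (hrm : r ≤ m + 2) : (2 : ℤ) ^ r ∣ a ^ (2 ^ m) - 1 := by
  obtain ⟨k, rfl⟩ := Nat.exists_eq_add_of_le' hm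
  have h8 : (2 : ℤ) ^ 3 ∣ a ^ 2 - 1 := by
    simpa using Int.eight_dvd_sq_sub_one_of_odd ha
  exact (pow_dvd_pow 2 (by omega)).trans
    ((two_pow_add_dvd_pow_two_pow_sub_one_iff ha 3 k).mpr h8)

theorem odd_of_pow_modEq_one {a : ℤ} {m n : ℕ} (hm : m ≠ 0) (hn : n ≠ 0)
    (h : a ^ m ≡ 1 [ZMOD (2 : ℤ) ^ n]) : Odd a := by
  have h2 : (2 : ℤ) ∣ 1 - a ^ m := (dvd_pow_self 2 hn).trans h.dvd
  by_contra hodd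
  have ha : (2 : ℤ) ∣ a ^ m := dvd_pow (Int.not_odd_iff_even.mp hodd).two_dvd hm
  omega

theorem stmt19 (r η : ℕ) (hr : 2 < r) (hη : 1 ≤ η) (a : ℕ) (ha : a < 2 ^ r) :
    ((a : ℤ) ^ (2 ^ η) ≡ 1 [ZMOD (2 : ℤ) ^ r] ↔
        (a : ℤ) ^ (2 ^ (min (r - 2) η)) ≡ 1 [ZMOD (2 : ℤ) ^ r]) ∧
    ((a : ℤ) ^ (2 ^ (min (r - 2) η)) ≡ 1 [ZMOD (2 : ℤ) ^ r] ↔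
        (a : ℤ) ^ 2 ≡ 1 [ZMOD (2 : ℤ) ^ (r + 1 - min (r - 2) η)]) := by
  by_cases hodd : Odd (a : ℤ)
  · simp only [Int.modEq_comm (b := 1), Int.modEq_iff_dvd]
    constructor
    · rcases le_total η (r - 2) with h | h
      · rw [min_eq_right h]
      · rw [min_eq_left h]
        exact iff_of_true (two_pow_dvd_pow_two_pow_sub_one hodd hη (by omega))
          (two_pow_dvd_pow_two_pow_sub_one hodd (by omega) (by omega))
    · obtain ⟨k, hk⟩ := Nat.exists_eq_add_of_le' (show 1 ≤ min (r - 2) η by omega)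
      have key := two_pow_add_dvd_pow_two_pow_sub_one_iff hodd (r - k) k
      rw [hk, show r + 1 - (k + 1) = r - k by omega]
      rwa [show r - k + k = r by omega] at key
  · have hpow (m : ℕ) : (2 : ℕ) ^ m ≠ 0 := pow_ne_zero m two_ne_zero
    have h1 := mt (odd_of_pow_modEq_one (hpow η) (show r ≠ 0 by omega)) hodd
    have h2 := mt (odd_of_pow_modEq_one (hpow (min (r - 2) η)) (show r ≠ 0 by omega)) hodd
    have h3 := mt (odd_of_pow_modEq_one two_ne_zero
      (show r + 1 - min (r - 2) η ≠ 0 by omega)) hodd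
    exact ⟨iff_of_false h1 h2, iff_of_false h2 h3⟩
end
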